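/- arXiv:1605.07252 — 4 statements merged into one kernel-verified Lean document; each statement's English description precedes it below -/
import Mathlib

section
/- Let L : ℝ^m → ℝ be a convex differentiable function, let θ* ∈ ℝ^m have at most d nonzero entries, and let λ > 0 satisfy λ ≥ 2‖∇L(θ*)‖_∞. Then every minimizer θ̂ of the map θ ↦ L(θ) + λ‖θ‖₁ satisfies ‖θ̂ − θ*‖₁ ≤ 4√d · ‖θ̂ − θ*‖₂, i.e. the estimation difference θ̂ − θ* lies in the cone K = {Δ ∈ ℝ^m : ‖Δ‖₁ ≤ 4√d·‖Δ‖₂}. -/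
open scoped BigOperators

/-- **Cone condition for ℓ₁-regularized M-estimators.**
Let `L : ℝ^m → ℝ` be convex and differentiable, let `θ*` have at most `d` nonzero entries,
and let `λ > 0` satisfy `λ ≥ 2‖∇L(θ*)‖_∞`. Then every minimizer `θ̂` of `L(θ) + λ‖θ‖₁`
satisfies `‖θ̂ - θ*‖₁ ≤ 4√d ‖θ̂ - θ*‖₂`, i.e. the estimation difference lies in the cone
`K = {Δ : ‖Δ‖₁ ≤ 4√d ‖Δ‖₂}`. -/
theorem stmt3 {m : ℕ} (d : ℕ) (L : EuclideanSpace ℝ (Fin m) → ℝ)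
    (θs : EuclideanSpace ℝ (Fin m)) (lam : ℝ)
    (hconv : ConvexOn ℝ Set.univ L) (hdiff : Differentiable ℝ L)
    (hsparse : (Finset.univ.filter fun i => θs i ≠ 0).card ≤ d)
    (hlam : 0 < lam)
    (hgrad : ∀ i, 2 * |gradient L θs i| ≤ lam) :
    ∀ θhat : EuclideanSpace ℝ (Fin m),
      (∀ v : EuclideanSpace ℝ (Fin m),
        L θhat + lam * ∑ i, |θhat i| ≤ L v + lam * ∑ i, |v i|) →
      (∑ i, |θhat i - θs i|) ≤ 4 * Real.sqrt d * ‖θhat - θs‖ := by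
  intro θhat hmin
  -- first-order convexity inequality
  have hfo : inner ℝ (gradient L θs) (θhat - θs) ≤ L θhat - L θs := by
    have hc : ConvexOn ℝ Set.univ (L ∘ (AffineMap.lineMap θs θhat : ℝ →ᵃ[ℝ] _)) := by
      simpa using hconv.comp_affineMap (AffineMap.lineMap θs θhat : ℝ →ᵃ[ℝ] _)
    have hg : HasFDerivAt L (fderiv ℝ L θs) (AffineMap.lineMap θs θhat (0 : ℝ)) := by
      simpa using (hdiff θs).hasFDerivAt
    have hd := hg.comp_hasDerivAt (0 : ℝ) AffineMap.hasDerivAt_lineMap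
    have h := hc.le_slope_of_hasDerivAt (Set.mem_univ 0) (Set.mem_univ 1) one_pos hd
    have he : inner ℝ (gradient L θs) (θhat - θs) = fderiv ℝ L θs (θhat - θs) := by
      simp [gradient]
    rw [he]
    simpa [slope_def_field] using h
  have hin : inner ℝ (gradient L θs) (θhat - θs)
      = ∑ i, gradient L θs i * (θhat i - θs i) := by
    rw [PiLp.inner_apply]
    simp [mul_comm]
  have hlow : -(lam / 2 * ∑ i, |θhat i - θs i|)
      ≤ ∑ i, gradient L θs i * (θhat i - θs i) := by
    rw [Finset.mul_sum, ← Finset.sum_neg_distrib]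
    refine Finset.sum_le_sum fun i _ => ?_
    have h1 := neg_abs_le (gradient L θs i * (θhat i - θs i))
    rw [abs_mul] at h1
    have h2 := mul_le_mul_of_nonneg_right (hgrad i) (abs_nonneg (θhat i - θs i))
    linarith
  have hm := hmin θs
  have hpt : ∑ i, |θs i| - ∑ i, |θhat i|
      ≤ 2 * (∑ i ∈ Finset.univ.filter (fun i => θs i ≠ 0), |θhat i - θs i|)
        - ∑ i, |θhat i - θs i| := by
    rw [Finset.sum_filter, Finset.mul_sum, ← Finset.sum_sub_distrib, ← Finset.sum_sub_distrib]
    refine Finset.sum_le_sum fun i _ => ?_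
    by_cases h : θs i = 0
    · simp [h]
    · have := abs_sub_abs_le_abs_sub (θs i) (θhat i)
      rw [abs_sub_comm] at this
      simp only [ne_eq, h, not_false_eq_true, if_true]
      linarith
  have hcs : (∑ i ∈ Finset.univ.filter (fun i => θs i ≠ 0), |θhat i - θs i|)
      ≤ Real.sqrt d * ‖θhat - θs‖ := by
    rw [EuclideanSpace.norm_eq, ← Real.sqrt_mul (Nat.cast_nonneg d)]
    refine Real.le_sqrt_of_sq_le (sq_sum_le_card_mul_sum_sq.trans ?_)
    refine mul_le_mul (by exact_mod_cast hsparse) ?_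
      (Finset.sum_nonneg fun i _ => sq_nonneg _) (Nat.cast_nonneg d)
    simp only [PiLp.sub_apply, Real.norm_eq_abs]
    exact Finset.sum_le_sum_of_subset_of_nonneg (Finset.subset_univ _)
      fun i _ _ => sq_nonneg _
  have hkey : lam * -(1 / 2 * ∑ i, |θhat i - θs i|)
      ≤ lam * (∑ i, |θs i| - ∑ i, |θhat i|) := by
    linarith
  have hkey' := le_of_mul_le_mul_left hkey hlam
  linarith
end

section
/- For any Ising model with zero magnetic field on p spins and any pair of distinct nodes u, l ∈ V, the random variable X_ul(θ*_u) = −σ_u σ_l exp(−∑_{i≠u} θ*_ui σ_u σ_i), with σ distributed according to μ, has zero mean: E[X_ul(θ*_u)] = 0. -/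
open scoped BigOperators Classical

noncomputable section

/-- The ±1 spin value associated to a Boolean. -/
def spin (b : Bool) : ℝ := if b then 1 else -1

/-- The energy term of the zero-field Ising model with (symmetric, zero-diagonal)
couplings `θ`: the sum over undirected edges of `θ i j * σ_i * σ_j`. -/
def ham {p : ℕ} (θ : Fin p → Fin p → ℝ) (σ : Fin p → Bool) : ℝ :=
  (1 / 2) * ∑ i, ∑ j, θ i j * spin (σ i) * spin (σ j)

/-- The Gibbs probability `μ(σ) = exp(ham θ σ) / Z`. -/
def gibbs {p : ℕ} (θ : Fin p → Fin p → ℝ) (σ : Fin p → Bool) : ℝ :=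
  Real.exp (ham θ σ) / ∑ τ : Fin p → Bool, Real.exp (ham θ τ)

/-- Probability of the event `P` under `n` i.i.d. samples from the Ising model. -/
def probn {p : ℕ} (θ : Fin p → Fin p → ℝ) (n : ℕ)
    (P : (Fin n → Fin p → Bool) → Prop) : ℝ :=
  ∑ σs : Fin n → Fin p → Bool, if P σs then ∏ k, gibbs θ (σs k) else 0

/-- The Interaction Screening Objective at node `u`. -/
def ISO {p : ℕ} (n : ℕ) (σs : Fin n → Fin p → Bool) (u : Fin p) (θu : Fin p → ℝ) : ℝ :=
  (1 / n : ℝ) *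
    ∑ k, Real.exp (-∑ i ∈ Finset.univ.erase u, θu i * spin (σs k u) * spin (σs k i))

/-- The gradient (vector of partial derivatives) of the Interaction Screening Objective. -/
def gradISO {p : ℕ} (n : ℕ) (σs : Fin n → Fin p → Bool) (u : Fin p) (θu : Fin p → ℝ)
    (l : Fin p) : ℝ :=
  (1 / n : ℝ) *
    ∑ k, (-(spin (σs k u) * spin (σs k l))) *
      Real.exp (-∑ i ∈ Finset.univ.erase u, θu i * spin (σs k u) * spin (σs k i))

/-- ℓ₁-norm of a coupling vector around node `u` (the `u`-entry is excluded). -/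
def l1 {p : ℕ} (u : Fin p) (x : Fin p → ℝ) : ℝ := ∑ i ∈ Finset.univ.erase u, |x i|

/-- ℓ₂-norm of a coupling vector around node `u` (the `u`-entry is excluded). -/
def l2 {p : ℕ} (u : Fin p) (x : Fin p → ℝ) : ℝ :=
  Real.sqrt (∑ i ∈ Finset.univ.erase u, x i ^ 2)

lemma ham_split {p : ℕ} (θ : Fin p → Fin p → ℝ)
    (hsymm : ∀ i j, θ i j = θ j i) (hdiag : ∀ i, θ i i = 0) (u : Fin p) (σ : Fin p → Bool) :
    ham θ σ + -∑ i ∈ Finset.univ.erase u, θ u i * spin (σ u) * spin (σ i) =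
      (1 / 2) * ∑ i ∈ Finset.univ.erase u, ∑ j ∈ Finset.univ.erase u,
        θ i j * spin (σ i) * spin (σ j) := by
  have h (f : Fin p → ℝ) : ∑ i, f i = f u + ∑ i ∈ Finset.univ.erase u, f i :=
    (Finset.add_sum_erase _ f (Finset.mem_univ u)).symm
  have h2 : ∑ i ∈ Finset.univ.erase u, θ i u * spin (σ i) * spin (σ u) =
      ∑ i ∈ Finset.univ.erase u, θ u i * spin (σ u) * spin (σ i) := by
    refine Finset.sum_congr rfl fun i _ => ?_
    rw [hsymm i u]; ring
  unfold ham
  simp only [h, Finset.sum_add_distrib, hdiag, h2]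
  ring

lemma spin_not (b : Bool) : spin (!b) = -spin b := by
  cases b <;> simp [spin]

/-- **Lemma 1 (zero mean of the ISO gradient terms).**
For any zero-field Ising model on `p` spins and any pair of distinct nodes `u ≠ l`, the
random variable `X_ul(θ*_u) = -σ_u σ_l exp(-∑_{i≠u} θ*_ui σ_u σ_i)` has zero mean under `μ`. -/
theorem stmt4 {p : ℕ} (θ : Fin p → Fin p → ℝ)
    (hsymm : ∀ i j, θ i j = θ j i) (hdiag : ∀ i, θ i i = 0)
    (u l : Fin p) (hul : u ≠ l) :
    ∑ σ : Fin p → Bool, gibbs θ σ *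
      (-(spin (σ u) * spin (σ l)) *
        Real.exp (-∑ i ∈ Finset.univ.erase u, θ u i * spin (σ u) * spin (σ i))) = 0 := by
  have key (σ : Fin p → Bool) : gibbs θ σ *
      (-(spin (σ u) * spin (σ l)) *
        Real.exp (-∑ i ∈ Finset.univ.erase u, θ u i * spin (σ u) * spin (σ i))) =
      -(spin (σ u) * spin (σ l)) *
        Real.exp ((1 / 2) * ∑ i ∈ Finset.univ.erase u, ∑ j ∈ Finset.univ.erase u,
          θ i j * spin (σ i) * spin (σ j)) / ∑ τ : Fin p → Bool, Real.exp (ham θ τ) := by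
    rw [← ham_split θ hsymm hdiag u σ, Real.exp_add]
    unfold gibbs
    ring
  simp only [key]
  have hflip (σ : Fin p → Bool) (i : Fin p) (hi : i ≠ u) :
      Function.update σ u (!σ u) i = σ i := Function.update_of_ne hi _ _
  have hinv : Function.Involutive (fun σ : Fin p → Bool => Function.update σ u (!σ u)) := by
    intro σ
    simp
  have hneg (F : (Fin p → Bool) → ℝ) (hF : ∀ σ, F (Function.update σ u (!σ u)) = -F σ) :
      ∑ σ, F σ = 0 := by
    have h1 := Equiv.sum_comp (Function.Involutive.toPerm _ hinv) F
    have h2 : ∑ σ, F (Function.Involutive.toPerm _ hinv σ) = -∑ σ, F σ := by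
      rw [← Finset.sum_neg_distrib]
      exact Finset.sum_congr rfl fun σ _ => hF σ
    linarith
  apply hneg
  intro σ
  have h3 : ∑ i ∈ Finset.univ.erase u, ∑ j ∈ Finset.univ.erase u,
      θ i j * spin (Function.update σ u (!σ u) i) * spin (Function.update σ u (!σ u) j) =
      ∑ i ∈ Finset.univ.erase u, ∑ j ∈ Finset.univ.erase u,
        θ i j * spin (σ i) * spin (σ j) := by
    refine Finset.sum_congr rfl fun i hi => Finset.sum_congr rfl fun j hj => ?_
    rw [hflip σ i (Finset.ne_of_mem_erase hi), hflip σ j (Finset.ne_of_mem_erase hj)]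
  rw [h3, hflip σ l hul.symm, Function.update_self, spin_not]
  ring
end
end

section
/- For any Ising model with zero magnetic field on p spins and any pair of distinct nodes u, l ∈ V, the random variable X_ul(θ*_u) = −σ_u σ_l exp(−∑_{i≠u} θ*_ui σ_u σ_i), with σ distributed according to μ, has second moment equal to one: E[X_ul(θ*_u)²] = 1. -/
open scoped BigOperators Classical

noncomputable section

/-- Flip the spin at node `u`. -/
def flipAt {p : ℕ} (u : Fin p) (σ : Fin p → Bool) : Fin p → Bool :=
  fun i => if i = u then !(σ i) else σ i

theorem flipAt_invol {p : ℕ} (u : Fin p) : Function.Involutive (flipAt u) := by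
  intro σ
  funext i
  by_cases h : i = u <;> simp [flipAt, h]

theorem spin_flipAt {p : ℕ} (u : Fin p) (σ : Fin p → Bool) (i : Fin p) :
    spin (flipAt u σ i) = spin (σ i) * (1 - 2 * (if i = u then 1 else 0)) := by
  by_cases h : i = u
  · subst h
    cases hs : σ i <;> norm_num [flipAt, spin, hs]
  · simp [flipAt, h]

theorem spin_sq (b : Bool) : spin b ^ 2 = 1 := by
  cases b <;> simp [spin]

theorem ham_flipAt {p : ℕ} (θ : Fin p → Fin p → ℝ)
    (hsymm : ∀ i j, θ i j = θ j i) (hdiag : ∀ i, θ i i = 0) (u : Fin p) (σ : Fin p → Bool) :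
    ham θ (flipAt u σ) = ham θ σ
      - 2 * ∑ i ∈ Finset.univ.erase u, θ u i * spin (σ u) * spin (σ i) := by
  have hS : ∑ i ∈ Finset.univ.erase u, θ u i * spin (σ u) * spin (σ i)
      = ∑ i, θ u i * spin (σ u) * spin (σ i) := by
    apply Finset.sum_erase
    simp [hdiag]
  have h1 : ∀ i j, θ i j * spin (flipAt u σ i) * spin (flipAt u σ j)
      = θ i j * spin (σ i) * spin (σ j)
        - 2 * (if i = u then θ u j * spin (σ u) * spin (σ j) else 0)
        - 2 * (if j = u then θ u i * spin (σ u) * spin (σ i) else 0) := by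
    intro i j
    rw [spin_flipAt, spin_flipAt]
    by_cases hi : i = u
    · by_cases hj : j = u
      · subst hi
        subst hj
        simp [hdiag]
      · subst hi
        simp only [hj, if_true, if_false]
        ring
    · by_cases hj : j = u
      · subst hj
        simp only [hi, if_true, if_false]
        rw [hsymm i j]
        ring
      · simp [hi, hj]
  have h2 : ∑ i, ∑ j, (if i = u then θ u j * spin (σ u) * spin (σ j) else 0)
      = ∑ i, θ u i * spin (σ u) * spin (σ i) := by
    rw [Finset.sum_comm]
    simp
  rw [hS]
  unfold ham
  simp only [h1, Finset.sum_sub_distrib, ← Finset.mul_sum]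
  rw [h2]
  simp only [Finset.sum_ite_eq', Finset.mem_univ, if_true]
  ring

/-- **Lemma 2 (unit second moment of the ISO gradient terms).**
For any zero-field Ising model on `p` spins and any pair of distinct nodes `u ≠ l`, the
random variable `X_ul(θ*_u) = -σ_u σ_l exp(-∑_{i≠u} θ*_ui σ_u σ_i)` has second moment 1. -/
theorem stmt5 {p : ℕ} (θ : Fin p → Fin p → ℝ)
    (hsymm : ∀ i j, θ i j = θ j i) (hdiag : ∀ i, θ i i = 0)
    (u l : Fin p) (hul : u ≠ l) :
    ∑ σ : Fin p → Bool, gibbs θ σ *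
      (-(spin (σ u) * spin (σ l)) *
        Real.exp (-∑ i ∈ Finset.univ.erase u, θ u i * spin (σ u) * spin (σ i))) ^ 2 = 1 := by
  have hZ : (∑ τ : Fin p → Bool, Real.exp (ham θ τ)) ≠ 0 :=
    (Finset.sum_pos (fun τ _ => Real.exp_pos _) Finset.univ_nonempty).ne'
  have hterm : ∀ σ : Fin p → Bool, gibbs θ σ *
      (-(spin (σ u) * spin (σ l)) *
        Real.exp (-∑ i ∈ Finset.univ.erase u, θ u i * spin (σ u) * spin (σ i))) ^ 2
      = Real.exp (ham θ (flipAt u σ)) / ∑ τ : Fin p → Bool, Real.exp (ham θ τ) := by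
    intro σ
    rw [mul_pow, neg_sq, mul_pow, spin_sq, spin_sq, one_mul, one_mul, ← Real.exp_nat_mul,
      gibbs, div_mul_eq_mul_div, ← Real.exp_add, ham_flipAt θ hsymm hdiag]
    congr 2
    push_cast
    ring
  simp_rw [hterm]
  rw [← Finset.sum_div, div_eq_one_iff_eq hZ]
  exact Equiv.sum_comp (flipAt_invol u).toPerm (fun τ => Real.exp (ham θ τ))
end
end

section
/- For every real number z, the function f(z) = e^{−z} − 1 + z satisfies f(z) ≥ z² / (2 + |z|). -/
theorem stmt8_aux : Monotone (fun z : ℝ => (2 + z) * Real.exp (-z) + z) := by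
  have hd : ∀ z : ℝ, HasDerivAt (fun z : ℝ => (2 + z) * Real.exp (-z) + z)
      ((1 * Real.exp (-z) + (2 + z) * (Real.exp (-z) * (-1))) + 1) z := by
    intro z
    exact (((hasDerivAt_id z).const_add 2).mul ((hasDerivAt_id z).neg.exp)).add (hasDerivAt_id z)
  apply monotone_of_deriv_nonneg (fun z => (hd z).differentiableAt)
  intro z
  rw [(hd z).deriv]
  have h1 := Real.add_one_le_exp z
  have h2 : Real.exp z * Real.exp (-z) = 1 := by rw [← Real.exp_add]; simp
  have h3 := mul_le_mul_of_nonneg_right h1 (Real.exp_pos (-z)).le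
  linarith

/-- For every real `z`, the function `f(z) = e^{-z} - 1 + z` satisfies
`f(z) ≥ z² / (2 + |z|)`. -/
theorem stmt8 (z : ℝ) : Real.exp (-z) - 1 + z ≥ z ^ 2 / (2 + |z|) := by
  rcases le_total 0 z with h | h
  · rw [abs_of_nonneg h, ge_iff_le, div_le_iff₀ (by linarith)]
    have := stmt8_aux h
    simp at this
    nlinarith
  · have h1 := Real.quadratic_le_exp_of_nonneg (neg_nonneg.mpr h)
    have h2 : z ^ 2 / (2 + |z|) ≤ z ^ 2 / 2 := by
      apply div_le_div_of_nonneg_left (sq_nonneg z) (by norm_num)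
      linarith [abs_nonneg z]
    nlinarith
end
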